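/- Let G be a free group with free basis a₁, …, aₙ, H a free group, and φ, ψ : G → H homomorphisms such that φ has remnant with |Rem_φ(aᵢ)| > |aᵢψ| for every i. Set l := min over 1 ≤ i ≤ n of (|Rem_φ(aᵢ)| − |aᵢψ|). Then for all u, v ∈ H, every z ∈ G satisfying (zφ)⁻¹·u·(zψ) = v has |z| ≤ (|u| + |v|)/l; that is, the pair (u, v) has bounded solution length with solution bound at most ⌈(|u| + |v|)/l⌉. -/

import Mathlib

/-- The number of letters cancelled in the product `u * v` of elements of a free group:
`c(u,v) = (|u| + |v| - |uv|)/2`. -/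
def cancel {κ : Type*} [DecidableEq κ] (u v : FreeGroup κ) : ℕ :=
  (FreeGroup.norm u + FreeGroup.norm v - FreeGroup.norm (u * v)) / 2

/-- The basis letter indexed by `(i, ε)`: `of i` if `ε = true`, `(of i)⁻¹` if `ε = false`. -/
def bLetter {ι : Type*} (p : ι × Bool) : FreeGroup ι :=
  cond p.2 (FreeGroup.of p.1) (FreeGroup.of p.1)⁻¹

/-- `P_χ(x_i)`: maximal cancellation of `x_iχ` with the image of a basis letter `b ≠ x_i⁻¹`
multiplied on the left. -/
def Pc {ι κ : Type*} [Fintype ι] [DecidableEq ι] [DecidableEq κ]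
    (χ : FreeGroup ι →* FreeGroup κ) (i : ι) : ℕ :=
  (Finset.univ.erase (i, false)).sup fun p => cancel (χ (bLetter p)) (χ (FreeGroup.of i))

/-- `S_χ(x_i)`: maximal cancellation of `x_iχ` with the image of a basis letter `b ≠ x_i⁻¹`
multiplied on the right. -/
def Sc {ι κ : Type*} [Fintype ι] [DecidableEq ι] [DecidableEq κ]
    (χ : FreeGroup ι →* FreeGroup κ) (i : ι) : ℕ :=
  (Finset.univ.erase (i, false)).sup fun p => cancel (χ (FreeGroup.of i)) (χ (bLetter p))

/-- `χ` has remnant if for every basis element a nontrivial subword of its image survives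
all the cancellations: `P_χ(x_i) + S_χ(x_i) < |x_iχ|`. -/
def HasRemnant {ι κ : Type*} [Fintype ι] [DecidableEq ι] [DecidableEq κ]
    (χ : FreeGroup ι →* FreeGroup κ) : Prop :=
  ∀ i : ι, Pc χ i + Sc χ i < FreeGroup.norm (χ (FreeGroup.of i))

/-- The remnant length `|Rem_χ(x_i)| = |x_iχ| - P_χ(x_i) - S_χ(x_i)`. -/
def RemLen {ι κ : Type*} [Fintype ι] [DecidableEq ι] [DecidableEq κ]
    (χ : FreeGroup ι →* FreeGroup κ) (i : ι) : ℕ :=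
  FreeGroup.norm (χ (FreeGroup.of i)) - Pc χ i - Sc χ i

namespace FreeGroup

variable {κ : Type*} [DecidableEq κ]

theorem norm_inv_mul_add_le {x y : FreeGroup κ} {p : List (κ × Bool)}
    (hx : p <+: x.toWord) (hy : p <+: y.toWord) :
    norm (x⁻¹ * y) + 2 * p.length ≤ norm x + norm y := by
  obtain ⟨s, hs⟩ := hx
  obtain ⟨t, ht⟩ := hy
  have h : x⁻¹ * y = mk (invRev s ++ t) := by
    rw [← mk_toWord (x := x), ← mk_toWord (x := y), ← hs, ← ht, ← mul_mk, ← mul_mk, ← mul_mk,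
      ← inv_mk]
    group
  have hn : norm (x⁻¹ * y) ≤ s.length + t.length := by
    rw [h]
    exact norm_mk_le.trans (by simp)
  have hx : norm x = p.length + s.length := by rw [norm, ← hs, List.length_append]
  have hy : norm y = p.length + t.length := by rw [norm, ← ht, List.length_append]
  omega

theorem exists_prefix_length_reduce_invRev_append (L₁ L₂ : List (κ × Bool))
    (h₁ : IsReduced L₁) (h₂ : IsReduced L₂) :
    ∃ p, p <+: L₁ ∧ p <+: L₂ ∧
      (reduce (invRev L₁ ++ L₂)).length + 2 * p.length = L₁.length + L₂.length := by
  induction L₁ generalizing L₂ with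
  | nil => exact ⟨[], by simp, by simp, by simp [h₂.reduce_eq]⟩
  | cons a s ih =>
    cases L₂ with
    | nil => exact ⟨[], by simp, by simp, by simp [reduce_invRev, h₁.reduce_eq]⟩
    | cons b t =>
      by_cases hab : a = b
      · subst hab
        obtain ⟨p, hp₁, hp₂, hp⟩ := ih t h₁.tail h₂.tail
        refine ⟨a :: p, by simpa using hp₁, by simpa using hp₂, ?_⟩
        have h : reduce (invRev (a :: s) ++ a :: t) = reduce (invRev s ++ t) := by
          apply reduce.sound
          rw [← List.singleton_append (l := s), ← List.singleton_append (l := t), ← mul_mk,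
            ← mul_mk, ← mul_mk, ← inv_mk, ← inv_mk, ← mul_mk]
          group
        rw [h]
        simp only [List.length_cons]
        omega
      · refine ⟨[], by simp, by simp, ?_⟩
        have h : IsReduced (invRev (a :: s) ++ b :: t) := by
          refine List.isChain_append.2 ⟨IsReduced.of_reduce_eq (by rw [reduce_invRev, h₁.reduce_eq]), h₂, ?_⟩
          simp only [invRev, List.map_cons, List.reverse_cons]
          rintro x hx y hy
          simp at hx hy
          subst hx hy
          rcases a with ⟨a, _ | _⟩ <;> rcases b with ⟨b, _ | _⟩ <;> simp_all
        rw [h.reduce_eq]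
        simp

theorem exists_prefix_norm_inv_mul (x y : FreeGroup κ) :
    ∃ p, p <+: x.toWord ∧ p <+: y.toWord ∧
      norm (x⁻¹ * y) + 2 * p.length = norm x + norm y := by
  have h := exists_prefix_length_reduce_invRev_append x.toWord y.toWord
    isReduced_toWord isReduced_toWord
  simpa [norm, toWord_mul, toWord_inv] using h

theorem norm_mul_add_two_mul_cancel (x y : FreeGroup κ) :
    norm (x * y) + 2 * cancel x y = norm x + norm y := by
  obtain ⟨p, -, -, hp⟩ := exists_prefix_norm_inv_mul x⁻¹ y
  rw [inv_inv, norm_inv_eq] at hp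
  unfold cancel
  omega

theorem cancel_inv_inv (x y : FreeGroup κ) : cancel y⁻¹ x⁻¹ = cancel x y := by
  rw [cancel, cancel, ← mul_inv_rev, norm_inv_eq, norm_inv_eq, norm_inv_eq, add_comm (norm y)]

theorem min_cancel_inv_le (x y z : FreeGroup κ) :
    min (cancel x⁻¹ y) (cancel y⁻¹ z) ≤ cancel x⁻¹ z := by
  obtain ⟨p, hpx, hpy, hp⟩ := exists_prefix_norm_inv_mul x y
  obtain ⟨q, hqy, hqz, hq⟩ := exists_prefix_norm_inv_mul y z
  have hxy := norm_mul_add_two_mul_cancel x⁻¹ y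
  have hyz := norm_mul_add_two_mul_cancel y⁻¹ z
  have hxz := norm_mul_add_two_mul_cancel x⁻¹ z
  rw [norm_inv_eq] at hxy hyz hxz
  rcases le_total p.length q.length with h | h
  · have := norm_inv_mul_add_le hpx ((List.prefix_of_prefix_length_le hpy hqy h).trans hqz)
    omega
  · have := norm_inv_mul_add_le ((List.prefix_of_prefix_length_le hqy hpy h).trans hpx) hqz
    omega

theorem cancel_mul_le_of_lt {x y z : FreeGroup κ} (h : cancel x y + cancel y z < norm y) :
    cancel (x * y) z ≤ cancel y z := by
  have hmin := min_cancel_inv_le y⁻¹ (y⁻¹ * x⁻¹) z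
  rw [inv_inv, mul_inv_rev, inv_inv, inv_inv] at hmin
  have hxy := norm_mul_add_two_mul_cancel x y
  have hy := norm_mul_add_two_mul_cancel y (y⁻¹ * x⁻¹)
  rw [mul_inv_cancel_left, ← mul_inv_rev, norm_inv_eq, norm_inv_eq] at hy
  rw [mul_inv_rev] at hy
  omega

end FreeGroup

open FreeGroup

section Remnant

variable {ι κ : Type*} [DecidableEq κ]

theorem bLetter_eq_mk (p : ι × Bool) : bLetter p = mk [p] := by
  rcases p with ⟨i, _ | _⟩ <;> rfl

theorem bLetter_not (i : ι) (b : Bool) : bLetter (i, !b) = (bLetter (i, b))⁻¹ := by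
  cases b <;> simp [bLetter]

theorem norm_map_bLetter (χ : FreeGroup ι →* FreeGroup κ) (p : ι × Bool) :
    norm (χ (bLetter p)) = norm (χ (of p.1)) := by
  rcases p with ⟨i, _ | _⟩ <;> simp [bLetter, norm_inv_eq]

theorem norm_map_mk_le (χ : FreeGroup ι →* FreeGroup κ) (w : List (ι × Bool)) :
    norm (χ (mk w)) ≤ (w.map fun p => norm (χ (of p.1))).sum := by
  induction w with
  | nil => simp [← one_eq_mk]
  | cons p w ih =>
    rw [← List.singleton_append, ← mul_mk, MonoidHom.map_mul, ← bLetter_eq_mk]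
    refine (FreeGroup.norm_mul_le _ _).trans ?_
    simpa [norm_map_bLetter] using ih

variable [Fintype ι] [DecidableEq ι]

/-- The maximal cancellation at the left end of the image of a signed letter. -/
def leftCancel (χ : FreeGroup ι →* FreeGroup κ) (p : ι × Bool) : ℕ :=
  cond p.2 (Pc χ p.1) (Sc χ p.1)

/-- The maximal cancellation at the right end of the image of a signed letter. -/
def rightCancel (χ : FreeGroup ι →* FreeGroup κ) (p : ι × Bool) : ℕ :=
  cond p.2 (Sc χ p.1) (Pc χ p.1)

theorem cancel_le_Pc (χ : FreeGroup ι →* FreeGroup κ) {i : ι} {p : ι × Bool}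
    (h : p ≠ (i, false)) : cancel (χ (bLetter p)) (χ (of i)) ≤ Pc χ i :=
  Finset.le_sup (f := fun p => cancel (χ (bLetter p)) (χ (of i))) (by simpa using h)

theorem cancel_le_Sc (χ : FreeGroup ι →* FreeGroup κ) {i : ι} {p : ι × Bool}
    (h : p ≠ (i, false)) : cancel (χ (of i)) (χ (bLetter p)) ≤ Sc χ i :=
  Finset.le_sup (f := fun p => cancel (χ (of i)) (χ (bLetter p))) (by simpa using h)

theorem cancel_le_leftCancel (χ : FreeGroup ι →* FreeGroup κ) {p q : ι × Bool}
    (h : p.1 = q.1 → p.2 = q.2) :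
    cancel (χ (bLetter p)) (χ (bLetter q)) ≤ leftCancel χ q := by
  rcases q with ⟨i, _ | _⟩
  · rw [← cancel_inv_inv, ← MonoidHom.map_inv, ← MonoidHom.map_inv, ← bLetter_not, ← bLetter_not]
    exact cancel_le_Sc χ (by grind)
  · exact cancel_le_Pc χ (by grind)

theorem cancel_le_rightCancel (χ : FreeGroup ι →* FreeGroup κ) {p q : ι × Bool}
    (h : p.1 = q.1 → p.2 = q.2) :
    cancel (χ (bLetter p)) (χ (bLetter q)) ≤ rightCancel χ p := by
  rcases p with ⟨i, _ | _⟩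
  · rw [← cancel_inv_inv, ← MonoidHom.map_inv, ← MonoidHom.map_inv, ← bLetter_not, ← bLetter_not]
    exact cancel_le_Pc χ (by grind)
  · exact cancel_le_Sc χ (by grind)

theorem HasRemnant.norm_map_bLetter_eq {χ : FreeGroup ι →* FreeGroup κ} (hχ : HasRemnant χ)
    (p : ι × Bool) :
    norm (χ (bLetter p)) = RemLen χ p.1 + leftCancel χ p + rightCancel χ p ∧
      0 < RemLen χ p.1 := by
  have h := hχ p.1
  rw [norm_map_bLetter]
  rcases p with ⟨i, _ | _⟩ <;> simp only [RemLen, leftCancel, rightCancel, cond] at h ⊢ <;> omega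

theorem HasRemnant.cancel_le_and_sum_le {χ : FreeGroup ι →* FreeGroup κ} (hχ : HasRemnant χ)
    (w : List (ι × Bool)) (q : ι × Bool) (hw : IsReduced (w ++ [q])) :
    cancel (χ (mk w)) (χ (bLetter q)) ≤ leftCancel χ q ∧
      (w.map fun p => RemLen χ p.1).sum + RemLen χ q.1 + rightCancel χ q ≤
        norm (χ (mk w) * χ (bLetter q)) := by
  induction w using List.reverseRecOn generalizing q with
  | nil =>
    have h := (hχ.norm_map_bLetter_eq q).1
    simp only [← one_eq_mk, MonoidHom.map_one, one_mul, cancel, FreeGroup.norm_one]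
    simp
    omega
  | append_singleton w p ih =>
    have hpq : p.1 = q.1 → p.2 = q.2 := by
      have := (List.isChain_append.1 hw).2.2
      simpa using this
    obtain ⟨hc, hs⟩ := ih p (List.isChain_append.1 hw).1
    rw [← mul_mk, MonoidHom.map_mul, ← bLetter_eq_mk]
    have hl := cancel_le_leftCancel χ hpq
    have hr := cancel_le_rightCancel χ hpq
    have hp := hχ.norm_map_bLetter_eq p
    have hq := hχ.norm_map_bLetter_eq q
    have hle : cancel (χ (mk w) * χ (bLetter p)) (χ (bLetter q)) ≤
        cancel (χ (bLetter p)) (χ (bLetter q)) := cancel_mul_le_of_lt (by omega)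
    have hn := norm_mul_add_two_mul_cancel (χ (mk w) * χ (bLetter p)) (χ (bLetter q))
    rw [List.map_append, List.sum_append, List.map_singleton, List.sum_singleton]
    omega

theorem HasRemnant.sum_remLen_le_norm {χ : FreeGroup ι →* FreeGroup κ} (hχ : HasRemnant χ)
    (z : FreeGroup ι) : (z.toWord.map fun p => RemLen χ p.1).sum ≤ norm (χ z) := by
  have hz := isReduced_toWord (x := z)
  conv_rhs => rw [← mk_toWord (x := z)]
  rcases List.eq_nil_or_concat' z.toWord with h | ⟨w, q, h⟩
  · simp [h]
  · rw [h] at hz ⊢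
    have := (hχ.cancel_le_and_sum_le w q hz).2
    rw [← mul_mk, MonoidHom.map_mul, ← bLetter_eq_mk, List.map_append, List.sum_append,
      List.map_singleton, List.sum_singleton]
    omega

end Remnant

/-- Theorem 3.11 (bounded solution length): if `φ` has remnant with
`|Rem_φ(aᵢ)| > |aᵢψ|` for all generators and
`l = min_i (|Rem_φ(aᵢ)| - |aᵢψ|)`, then every `z` with `(zφ)⁻¹ u (zψ) = v` satisfies
`|z| ≤ (|u| + |v|)/l`. -/
theorem bounded_solution_length {n : ℕ} {κ : Type*} [DecidableEq κ]
    (φ ψ : FreeGroup (Fin n) →* FreeGroup κ)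
    (hrem : HasRemnant φ)
    (hgt : ∀ i : Fin n, FreeGroup.norm (ψ (FreeGroup.of i)) < RemLen φ i)
    (hn : 0 < n) (l : ℕ)
    (hl : l = Finset.univ.inf' (Finset.univ_nonempty_iff.mpr (Fin.pos_iff_nonempty.mp hn))
        fun i : Fin n => RemLen φ i - FreeGroup.norm (ψ (FreeGroup.of i)))
    (u v : FreeGroup κ) (z : FreeGroup (Fin n))
    (hz : (φ z)⁻¹ * u * ψ z = v) :
    (FreeGroup.norm z : ℚ) ≤ (FreeGroup.norm u + FreeGroup.norm v) / l := by
  have hl_le (i : Fin n) : l + norm (ψ (of i)) ≤ RemLen φ i := by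
    have h : l ≤ RemLen φ i - norm (ψ (of i)) := hl ▸ Finset.inf'_le _ (Finset.mem_univ i)
    have := hgt i
    omega
  have hl_pos : 0 < l := by
    rw [hl, Finset.lt_inf'_iff]
    exact fun i _ => Nat.sub_pos_of_lt (hgt i)
  have hsum : norm z * l + (z.toWord.map fun p => norm (ψ (of p.1))).sum ≤
      (z.toWord.map fun p => RemLen φ p.1).sum := by
    rw [FreeGroup.norm]
    induction z.toWord with
    | nil => simp
    | cons p w ih =>
      have := hl_le p.1
      simp only [List.length_cons, List.map_cons, List.sum_cons, add_one_mul]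
      omega
  have hφ := hrem.sum_remLen_le_norm z
  have hψ := norm_map_mk_le ψ z.toWord
  rw [mk_toWord] at hψ
  have huv : norm (φ z) ≤ norm u + norm (ψ z) + norm v := by
    have h : φ z = u * ψ z * v⁻¹ := by
      rw [← hz]
      group
    rw [h]
    refine (FreeGroup.norm_mul_le _ _).trans ?_
    rw [norm_inv_eq]
    exact Nat.add_le_add_right (FreeGroup.norm_mul_le _ _) _
  rw [le_div_iff₀ (by exact_mod_cast hl_pos)]
  exact_mod_cast (by omega : norm z * l ≤ norm u + norm v)
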